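/- arXiv:2211.03497 — 4 statements merged into one kernel-verified Lean document; each statement's English description precedes it below -/
import Mathlib

section
/- The function r ↦ erf(μr/2)/r (μ > 0) extends to an even, real-analytic function h on all of ℝ satisfying h(0) = μ/√π; moreover h(r) → 0 and r·h(r) → 1 as r → ∞. Consequently, the non-local metric potential φ(r) = -(Gm/r) erf(μr/2) is non-singular at the origin, with limiting value φ(0) = -Gmμ/√π, and recovers the Newtonian behaviour φ(r) ≈ -Gm/r at large distances (lim_{r→∞} r·φ(r) = -Gm). -/
open Real MeasureTheory Set Filter Topology

/-- The error function `erf x = (2/√π) ∫₀^x e^{-t²} dt`. -/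
noncomputable def erf (x : ℝ) : ℝ := (2 / Real.sqrt π) * ∫ t in (0:ℝ)..x, Real.exp (-t ^ 2)

theorem erf_zero : erf 0 = 0 := by simp [erf]

theorem erf_neg (x : ℝ) : erf (-x) = -erf x := by
  have h := intervalIntegral.integral_comp_neg (a := 0) (b := x) fun t : ℝ => Real.exp (-t ^ 2)
  simp only [neg_sq, neg_zero] at h
  rw [erf, erf, h, intervalIntegral.integral_symm, mul_neg]

theorem hasDerivAt_erf (x : ℝ) :
    HasDerivAt erf (2 / Real.sqrt π * Real.exp (-x ^ 2)) x := by
  have hc : Continuous fun t : ℝ => Real.exp (-t ^ 2) := by fun_prop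
  exact (intervalIntegral.integral_hasDerivAt_right (hc.intervalIntegrable 0 x)
    (hc.stronglyMeasurableAtFilter _ _) hc.continuousAt).const_mul _

theorem analyticAt_erf (x : ℝ) : AnalyticAt ℝ erf x := by
  have hd : Differentiable ℂ fun z : ℂ => Complex.exp (-z ^ 2) := by fun_prop
  obtain ⟨F, hF⟩ := hd.isExactOn_univ
  have hFa : AnalyticAt ℂ F x :=
    Differentiable.analyticAt (fun z => (hF z (mem_univ z)).differentiableAt) _
  have hre : ∀ y : ℝ, HasDerivAt (fun y : ℝ => (F y).re) (Real.exp (-y ^ 2)) y := fun y => by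
    convert! (hF y (mem_univ _)).real_of_complex using 1
    rw [← Complex.exp_ofReal_re]
    push_cast
    rfl
  have herf : erf = fun y : ℝ => 2 / Real.sqrt π * ((F y).re - (F (0 : ℝ)).re) := by
    funext y
    have hc : Continuous fun t : ℝ => Real.exp (-t ^ 2) := by fun_prop
    rw [erf, intervalIntegral.integral_eq_sub_of_hasDerivAt (fun t _ => hre t)
      (hc.intervalIntegrable 0 y)]
  rw [herf]
  exact analyticAt_const.mul (hFa.re_ofReal.sub analyticAt_const)

theorem tendsto_erf_atTop : Tendsto erf atTop (𝓝 1) := by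
  have hint : IntegrableOn (fun t : ℝ => Real.exp (-t ^ 2)) (Ioi 0) := by
    simpa using (integrable_exp_neg_mul_sq one_pos).integrableOn (s := Ioi (0 : ℝ))
  have hval : ∫ t in Ioi (0 : ℝ), Real.exp (-t ^ 2) = Real.sqrt π / 2 := by
    simpa using integral_gaussian_Ioi 1
  have h := (intervalIntegral_tendsto_integral_Ioi 0 hint tendsto_id).const_mul (2 / Real.sqrt π)
  rw [hval, div_mul_div_cancel₀ (by positivity), div_self two_ne_zero] at h
  exact h

theorem AnalyticAt.dslope {𝕜 E : Type*} [NontriviallyNormedField 𝕜] [NormedAddCommGroup E]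
    [NormedSpace 𝕜 E] {f : 𝕜 → E} {a b : 𝕜} (ha : AnalyticAt 𝕜 f a) (hb : AnalyticAt 𝕜 f b) :
    AnalyticAt 𝕜 (dslope f a) b := by
  rcases eq_or_ne b a with rfl | hne
  · obtain ⟨p, hp⟩ := ha
    exact hp.has_fpower_series_dslope_fslope.analyticAt
  · refine AnalyticAt.congr ?_ (dslope_eventuallyEq_slope_of_ne f hne).symm
    exact ((analyticAt_id.sub analyticAt_const).inv (sub_ne_zero.2 hne)).smul
      (hb.sub analyticAt_const)

/-- The function `r ↦ erf(μr/2)/r` extends to an even real-analytic function `h` on `ℝ` with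
`h(0) = μ/√π`, `h(r) → 0` and `r h(r) → 1` as `r → ∞`. Consequently the non-local metric
potential `φ(r) = -(Gm/r) erf(μr/2)` is non-singular at the origin, with limiting value
`-Gmμ/√π`, and recovers the Newtonian behaviour `φ ≈ -Gm/r` at large distances. -/
theorem gaussian_potential_regular
    (G m μ : ℝ) (hG : 0 < G) (hm : 0 < m) (hμ : 0 < μ)
    (φ : ℝ → ℝ) (hφ : ∀ r : ℝ, φ r = -(G * m / r) * erf (μ * r / 2)) :
    ∃ h : ℝ → ℝ,
      (∀ r : ℝ, r ≠ 0 → h r = erf (μ * r / 2) / r) ∧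
      (∀ r : ℝ, h (-r) = h r) ∧
      (∀ r : ℝ, AnalyticAt ℝ h r) ∧
      h 0 = μ / Real.sqrt π ∧
      Tendsto h atTop (nhds 0) ∧
      Tendsto (fun r => r * h r) atTop (nhds 1) ∧
      Tendsto φ (nhdsWithin 0 (Ioi 0)) (nhds (-(G * m * μ / Real.sqrt π))) ∧
      Tendsto (fun r => r * φ r) atTop (nhds (-(G * m))) := by
  set f : ℝ → ℝ := fun r => erf (μ * r / 2) with hf
  have hf0 : f 0 = 0 := by simp [hf, erf_zero]
  have hfa : ∀ r, AnalyticAt ℝ f r := fun r =>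
    (analyticAt_erf _).fun_comp (f := fun r : ℝ => μ * r / 2) (by fun_prop)
  have hne : ∀ r : ℝ, r ≠ 0 → dslope f 0 r = f r / r := fun r hr => by
    rw [dslope_of_ne _ hr, slope_def_field, hf0, sub_zero, sub_zero]
  have hzero : dslope f 0 0 = μ / Real.sqrt π := by
    have hlin : HasDerivAt (fun r : ℝ => μ * r / 2) (μ / 2) 0 := by
      simpa using ((hasDerivAt_id (0 : ℝ)).const_mul μ).div_const 2
    have hd := (hasDerivAt_erf (μ * 0 / 2)).comp (0 : ℝ) hlin
    rw [dslope_same]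
    refine hd.deriv.trans ?_
    simp
  have han : ∀ r, AnalyticAt ℝ (dslope f 0) r := fun r => (hfa 0).dslope (hfa r)
  have hflim : Tendsto f atTop (𝓝 1) :=
    tendsto_erf_atTop.comp ((tendsto_id.const_mul_atTop hμ).atTop_div_const two_pos)
  have hφne : ∀ r : ℝ, r ≠ 0 → -(G * m) * dslope f 0 r = φ r := fun r hr => by
    rw [hφ, hne r hr]
    ring
  have hrh : Tendsto (fun r => r * dslope f 0 r) atTop (𝓝 1) := by
    refine hflim.congr' ?_
    filter_upwards [eventually_ne_atTop 0] with r hr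
    rw [hne r hr, mul_div_cancel₀ _ hr]
  refine ⟨dslope f 0, hne, fun r => ?_, han, hzero, ?_, hrh, ?_, ?_⟩
  · rcases eq_or_ne r 0 with rfl | hr
    · rw [neg_zero]
    · rw [hne r hr, hne (-r) (neg_ne_zero.2 hr)]
      simp only [hf, mul_neg, neg_div, erf_neg, div_neg, neg_neg]
  · refine (hflim.div_atTop tendsto_id).congr' ?_
    filter_upwards [eventually_ne_atTop 0] with r hr
    exact (hne r hr).symm
  · have h := ((han 0).continuousAt.tendsto.const_mul (-(G * m))).mono_left
      (nhdsWithin_le_nhds (s := Ioi (0 : ℝ)))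
    rw [hzero, neg_mul, ← mul_div_assoc] at h
    refine h.congr' ?_
    filter_upwards [self_mem_nhdsWithin] with r hr
    exact hφne r (ne_of_gt hr)
  · have h := hrh.const_mul (-(G * m))
    rw [mul_one] at h
    refine h.congr' ?_
    filter_upwards [eventually_ne_atTop 0] with r hr
    rw [← hφne r hr]
    ring
end

section
/- Let K(r) = (G²m²/(3π r⁶)) · e^{-μ²r²/2} · { 5μ⁶r⁶ + 4·[ 6μr + μ³r³ − 6√π e^{μ²r²/4} erf(μr/2) ]² } with G, m, μ > 0. Then lim_{r→0⁺} K(r) = 5 G² m² μ⁶ / (3π); in particular the linearised Kretschmann invariant of the Gaussian non-local metric is bounded at the origin. -/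
open Real MeasureTheory Set Filter Topology

/-- The derivative of the combination `e^{-s²}(s + 2s³/3) - ∫₀^s e^{-t²} dt` is `-(4/3) s⁴ e^{-s²}`. -/
theorem hasDerivAt_exp_neg_sq_mul_sub_integral (s : ℝ) :
    HasDerivAt (fun s : ℝ => Real.exp (-s ^ 2) * (s + 2 / 3 * s ^ 3) -
      ∫ t in (0 : ℝ)..s, Real.exp (-t ^ 2)) (-(4 / 3) * s ^ 4 * Real.exp (-s ^ 2)) s := by
  have hc : Continuous fun t : ℝ => Real.exp (-t ^ 2) := by fun_prop
  have hF := (hc.integral_hasStrictDerivAt 0 s).hasDerivAt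
  have hE : HasDerivAt (fun s : ℝ => Real.exp (-s ^ 2)) _ s := ((hasDerivAt_pow 2 s).neg).exp
  have hP := (hasDerivAt_id s).add ((hasDerivAt_pow 3 s).const_mul (2 / 3 : ℝ))
  refine ((hE.mul hP).sub hF).congr_deriv ?_
  simp
  ring

theorem abs_exp_neg_sq_mul_sub_integral_le {s : ℝ} (hs : 0 ≤ s) :
    |Real.exp (-s ^ 2) * (s + 2 / 3 * s ^ 3) - ∫ t in (0 : ℝ)..s, Real.exp (-t ^ 2)|
      ≤ 4 / 3 * s ^ 5 := by
  have h := (convex_Icc 0 s).norm_image_sub_le_of_norm_hasDerivWithin_le (C := 4 / 3 * s ^ 4)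
    (fun x _ => (hasDerivAt_exp_neg_sq_mul_sub_integral x).hasDerivWithinAt)
    (fun x hx => ?_) (left_mem_Icc.2 hs) (right_mem_Icc.2 hs)
  · simp only [intervalIntegral.integral_same, Real.norm_eq_abs, sub_zero, abs_of_nonneg hs] at h
    norm_num at h
    linarith
  · have hx4 : x ^ 4 ≤ s ^ 4 := pow_le_pow_left₀ hx.1 hx.2 4
    have he : Real.exp (-x ^ 2) ≤ 1 := Real.exp_le_one_iff.2 (by nlinarith [sq_nonneg x])
    rw [Real.norm_eq_abs, abs_mul, abs_mul, Real.abs_exp, abs_neg, abs_of_pos (by norm_num),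
      abs_of_nonneg (by positivity)]
    calc 4 / 3 * x ^ 4 * Real.exp (-x ^ 2) ≤ 4 / 3 * x ^ 4 * 1 := by gcongr
      _ ≤ 4 / 3 * s ^ 4 := by linarith

theorem tendsto_exp_neg_sq_mul_sub_integral_div_cube :
    Tendsto (fun s : ℝ => (Real.exp (-s ^ 2) * (s + 2 / 3 * s ^ 3) -
      ∫ t in (0 : ℝ)..s, Real.exp (-t ^ 2)) / s ^ 3) (𝓝[>] 0) (𝓝 0) := by
  have hz : Tendsto (fun s : ℝ => 4 / 3 * s ^ 2) (𝓝[>] 0) (𝓝 0) :=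
    tendsto_nhdsWithin_of_tendsto_nhds (Continuous.tendsto' (by fun_prop) _ _ (by simp))
  refine squeeze_zero_norm' ?_ hz
  filter_upwards [self_mem_nhdsWithin] with s hs
  have hs : 0 < s := hs
  rw [Real.norm_eq_abs, abs_div, abs_of_pos (pow_pos hs 3), div_le_iff₀ (pow_pos hs 3)]
  exact (abs_exp_neg_sq_mul_sub_integral_le hs.le).trans_eq (by ring)

/-- The linearised Kretschmann invariant of the Gaussian non-local metric,
`K(r) = (G²m²/(3πr⁶)) e^{-μ²r²/2} {5μ⁶r⁶ + 4[6μr + μ³r³ − 6√π e^{μ²r²/4} erf(μr/2)]²}`,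
is bounded at the origin, with `K(r) → 5G²m²μ⁶/(3π)` as `r → 0⁺`. -/
theorem kretschmann_bounded_at_origin
    (G m μ : ℝ) (hG : 0 < G) (hm : 0 < m) (hμ : 0 < μ)
    (K : ℝ → ℝ)
    (hK : ∀ r : ℝ, K r = G ^ 2 * m ^ 2 / (3 * π * r ^ 6) * Real.exp (-μ ^ 2 * r ^ 2 / 2) *
      (5 * μ ^ 6 * r ^ 6 +
        4 * (6 * μ * r + μ ^ 3 * r ^ 3 -
          6 * Real.sqrt π * Real.exp (μ ^ 2 * r ^ 2 / 4) * erf (μ * r / 2)) ^ 2)) :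
    Tendsto K (nhdsWithin 0 (Ioi 0)) (nhds (5 * G ^ 2 * m ^ 2 * μ ^ 6 / (3 * π))) := by
  have hs : Tendsto (fun r : ℝ => μ * r / 2) (𝓝[>] 0) (𝓝[>] 0) := by
    refine tendsto_nhdsWithin_iff.2 ⟨tendsto_nhdsWithin_of_tendsto_nhds
      (Continuous.tendsto' (by fun_prop) _ _ (by simp)), ?_⟩
    filter_upwards [self_mem_nhdsWithin] with r hr
    have hr : 0 < r := hr
    exact mem_Ioi.2 (by positivity)
  have hq := tendsto_exp_neg_sq_mul_sub_integral_div_cube.comp hs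
  have hE : Tendsto (fun r : ℝ => Real.exp (-μ ^ 2 * r ^ 2 / 2)) (𝓝[>] 0) (𝓝 1) :=
    tendsto_nhdsWithin_of_tendsto_nhds (Continuous.tendsto' (by fun_prop) _ _ (by simp))
  have hE' : Tendsto (fun r : ℝ => 3 / 2 * μ ^ 3 * Real.exp (μ ^ 2 * r ^ 2 / 4)) (𝓝[>] 0)
      (𝓝 (3 / 2 * μ ^ 3)) :=
    tendsto_nhdsWithin_of_tendsto_nhds (Continuous.tendsto' (by fun_prop) _ _ (by simp))
  have hlim := (hE.const_mul (G ^ 2 * m ^ 2 / (3 * π))).mul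
    ((((hE'.mul hq).pow 2).const_mul 4).const_add (5 * μ ^ 6))
  have hval : G ^ 2 * m ^ 2 / (3 * π) * 1 * (5 * μ ^ 6 + 4 * (3 / 2 * μ ^ 3 * 0) ^ 2) =
      5 * G ^ 2 * m ^ 2 * μ ^ 6 / (3 * π) := by ring
  rw [hval] at hlim
  refine hlim.congr' ?_
  filter_upwards [self_mem_nhdsWithin] with r hr
  have hr : 0 < r := hr
  have hexp : Real.exp (-(μ * r / 2) ^ 2) = (Real.exp (μ ^ 2 * r ^ 2 / 4))⁻¹ := by
    rw [← Real.exp_neg]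
    congr 1
    ring
  have hpi : Real.sqrt π ≠ 0 := (Real.sqrt_pos.2 Real.pi_pos).ne'
  have hpos := (Real.exp_pos (μ ^ 2 * r ^ 2 / 4)).ne'
  have hb : 6 * μ * r + μ ^ 3 * r ^ 3 -
      6 * Real.sqrt π * Real.exp (μ ^ 2 * r ^ 2 / 4) * erf (μ * r / 2) =
      r ^ 3 * (3 / 2 * μ ^ 3 * Real.exp (μ ^ 2 * r ^ 2 / 4) *
        ((Real.exp (-(μ * r / 2) ^ 2) * (μ * r / 2 + 2 / 3 * (μ * r / 2) ^ 3) -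
          ∫ t in (0 : ℝ)..(μ * r / 2), Real.exp (-t ^ 2)) / (μ * r / 2) ^ 3)) := by
    rw [hexp, erf]
    generalize (∫ t in (0 : ℝ)..(μ * r / 2), Real.exp (-t ^ 2)) = I
    generalize Real.exp (μ ^ 2 * r ^ 2 / 4) = E at hpos ⊢
    field_simp
    ring
  rw [hK, hb]
  simp only [Function.comp_apply]
  generalize 3 / 2 * μ ^ 3 * Real.exp (μ ^ 2 * r ^ 2 / 4) *
        ((Real.exp (-(μ * r / 2) ^ 2) * (μ * r / 2 + 2 / 3 * (μ * r / 2) ^ 3) -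
          ∫ t in (0 : ℝ)..(μ * r / 2), Real.exp (-t ^ 2)) / (μ * r / 2) ^ 3) = Q
  field_simp
end

section
/- Let K(r) = (G²m²/(3π r⁶)) · e^{-μ²r²/2} · { 5μ⁶r⁶ + 4·[ 6μr + μ³r³ − 6√π e^{μ²r²/4} erf(μr/2) ]² } with G, m, μ > 0. Then lim_{r→∞} r⁶ · K(r) = 48 G² m²; i.e., at large distances K(r) behaves as 48G²m²/r⁶, recovering the general-relativistic (Schwarzschild) expression of the linearised Kretschmann invariant. -/
open Real MeasureTheory Set Filter Topology

theorem tendsto_pow_mul_exp_neg_sq_div_four (n : ℕ) :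
    Tendsto (fun s : ℝ => s ^ n * Real.exp (-s ^ 2 / 4)) atTop (𝓝 0) := by
  refine tendsto_of_tendsto_of_tendsto_of_le_of_le' tendsto_const_nhds
    (tendsto_pow_mul_exp_neg_atTop_nhds_zero n) ?_ ?_
  · filter_upwards [eventually_ge_atTop 0] with s hs
    positivity
  · filter_upwards [eventually_ge_atTop 4] with s hs
    have : -s ^ 2 / 4 ≤ -s := by nlinarith
    gcongr

/-- At large distances the linearised Kretschmann invariant of the Gaussian non-local metric,
`K(r) = (G²m²/(3πr⁶)) e^{-μ²r²/2} {5μ⁶r⁶ + 4[6μr + μ³r³ − 6√π e^{μ²r²/4} erf(μr/2)]²}`,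
recovers the general-relativistic behaviour: `r⁶ K(r) → 48 G²m²` as `r → ∞`. -/
theorem kretschmann_recovers_GR
    (G m μ : ℝ) (hG : 0 < G) (hm : 0 < m) (hμ : 0 < μ)
    (K : ℝ → ℝ)
    (hK : ∀ r : ℝ, K r = G ^ 2 * m ^ 2 / (3 * π * r ^ 6) * Real.exp (-μ ^ 2 * r ^ 2 / 2) *
      (5 * μ ^ 6 * r ^ 6 +
        4 * (6 * μ * r + μ ^ 3 * r ^ 3 -
          6 * Real.sqrt π * Real.exp (μ ^ 2 * r ^ 2 / 4) * erf (μ * r / 2)) ^ 2)) :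
    Tendsto (fun r => r ^ 6 * K r) atTop (nhds (48 * G ^ 2 * m ^ 2)) := by
  have hs : Tendsto (fun r : ℝ => μ * r) atTop atTop := tendsto_id.const_mul_atTop hμ
  have hE (n : ℕ) := (tendsto_pow_mul_exp_neg_sq_div_four n).comp hs
  have herf := tendsto_erf_atTop.comp (hs.atTop_div_const two_pos)
  have hlim := ((((hE 6).mul (hE 0)).const_mul 5).add
    ((((((hE 1).const_mul 6).add (hE 3)).sub (herf.const_mul (6 * √π))).pow 2).const_mul 4)).const_mul
      (G ^ 2 * m ^ 2 / (3 * π))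
  have hπ : √π ^ 2 = π := Real.sq_sqrt pi_pos.le
  have hval : G ^ 2 * m ^ 2 / (3 * π) *
      (5 * (0 * 0) + 4 * (6 * 0 + 0 - 6 * √π * 1) ^ 2) = 48 * G ^ 2 * m ^ 2 := by
    have := pi_ne_zero
    ring_nf
    rw [hπ]
    field_simp
  rw [hval] at hlim
  refine hlim.congr' ?_
  filter_upwards [eventually_gt_atTop 0] with r hr
  have hsq : Real.exp (-μ ^ 2 * r ^ 2 / 2) = Real.exp (-(μ * r) ^ 2 / 4) ^ 2 := by
    rw [← Real.exp_nat_mul]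
    congr 1
    push_cast
    ring
  have hinv : Real.exp (μ ^ 2 * r ^ 2 / 4) = (Real.exp (-(μ * r) ^ 2 / 4))⁻¹ := by
    rw [← Real.exp_neg]
    congr 1
    ring
  have hne : Real.exp (-(μ * r) ^ 2 / 4) ≠ 0 := (Real.exp_pos _).ne'
  simp only [Function.comp_apply]
  rw [hK, hsq, hinv]
  generalize Real.exp (-(μ * r) ^ 2 / 4) = E at hne ⊢
  generalize erf (μ * r / 2) = e
  field_simp
end

section
/- Fix G, μ > 0 and define g(r) = (4/(√π r)) ∫₀^{μ²r²/4} √t e^{-t} dt for r > 0. Then g is continuous and positive on (0,∞), g(r) → 0 as r → 0⁺ and as r → ∞, and g attains a finite positive maximum S = max_{r>0} g(r). Consequently there exists a critical mass m_c = 1/(G·S) > 0 such that, for the lapse function A_m(r) = 1 − G m g(r) of the non-local Schwarzschild-like solution, one has: A_m(r) > 0 for all r > 0 if and only if m < m_c (mass gap for black hole formation). -/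
open Real MeasureTheory Set Filter Topology

lemma continuous_sqrt_mul_exp_neg : Continuous fun t : ℝ => Real.sqrt t * Real.exp (-t) := by
  fun_prop

lemma sqrt_mul_exp_neg_le_one {t : ℝ} (ht : 0 ≤ t) : Real.sqrt t * Real.exp (-t) ≤ 1 := by
  have h1 : Real.sqrt t ≤ Real.exp t := by
    have h2 := Real.add_one_le_exp t
    have h3 := Real.sq_sqrt ht
    nlinarith [sq_nonneg (Real.sqrt t - 1)]
  calc Real.sqrt t * Real.exp (-t) ≤ Real.exp t * Real.exp (-t) := by gcongr
    _ = 1 := by rw [← Real.exp_add]; simp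

lemma integral_sqrt_mul_exp_neg_pos {x : ℝ} (hx : 0 < x) :
    0 < ∫ t in (0:ℝ)..x, Real.sqrt t * Real.exp (-t) :=
  intervalIntegral.intervalIntegral_pos_of_pos_on
    (continuous_sqrt_mul_exp_neg.intervalIntegrable _ _)
    (fun _ ht => mul_pos (Real.sqrt_pos.2 ht.1) (Real.exp_pos _)) hx

lemma integral_sqrt_mul_exp_neg_le {x : ℝ} (hx : 0 ≤ x) :
    ∫ t in (0:ℝ)..x, Real.sqrt t * Real.exp (-t) ≤ x := by
  have h := intervalIntegral.integral_mono_on hx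
    (continuous_sqrt_mul_exp_neg.intervalIntegrable (μ := volume) _ _)
    (continuous_const.intervalIntegrable (μ := volume) _ _)
    (fun t ht => sqrt_mul_exp_neg_le_one ht.1)
  simpa using h

lemma integrableOn_sqrt_mul_exp_neg :
    IntegrableOn (fun t : ℝ => Real.sqrt t * Real.exp (-t)) (Ioi 0) := by
  refine (Real.GammaIntegral_convergent (s := 3 / 2) (by norm_num)).congr_fun
    (fun t _ => ?_) measurableSet_Ioi
  rw [Real.sqrt_eq_rpow, mul_comm]
  norm_num

/-- A continuous function on `(0,∞)` that is positive somewhere and vanishes at both ends attains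
its maximum. -/
lemma exists_forall_le_of_tendsto_zero {f : ℝ → ℝ} (hf : ContinuousOn f (Ioi 0))
    {c : ℝ} (hc : 0 < c) (hfc : 0 < f c)
    (h0 : Tendsto f (𝓝[>] 0) (𝓝 0)) (htop : Tendsto f atTop (𝓝 0)) :
    ∃ r₀ : ℝ, 0 < r₀ ∧ ∀ r : ℝ, 0 < r → f r ≤ f r₀ := by
  obtain ⟨a, ha, hfa⟩ := mem_nhdsGT_iff_exists_Ioo_subset.1 (h0.eventually_lt_const hfc)
  obtain ⟨b, hfb⟩ := eventually_atTop.1 (htop.eventually_lt_const hfc)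
  have ha : 0 < a := ha
  have hca : a ≤ c := by
    by_contra! h
    exact lt_irrefl (f c) (hfa ⟨hc, h⟩)
  have hcb : c ≤ b := by
    by_contra! h
    exact lt_irrefl _ (hfb c h.le)
  obtain ⟨r₀, hr₀, hmax⟩ := isCompact_Icc.exists_isMaxOn ⟨c, hca, hcb⟩
    (hf.mono fun r (hr : r ∈ Icc a b) => ha.trans_le hr.1)
  refine ⟨r₀, ha.trans_le hr₀.1, fun r hr => ?_⟩
  have hle : f c ≤ f r₀ := hmax ⟨hca, hcb⟩
  rcases lt_or_ge r a with h | h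
  · exact (hfa ⟨hr, h⟩ : f r < f c).le.trans hle
  rcases le_or_gt r b with h' | h'
  · exact hmax ⟨h, h'⟩
  · exact (hfb r h'.le).le.trans hle

/-- Mass gap for black hole formation in Gaussian non-local gravity: the profile
`g(r) = (4/(√π r)) ∫₀^{μ²r²/4} √t e^{-t} dt` is continuous and positive on `(0,∞)`, vanishes
in the limits `r → 0⁺` and `r → ∞`, and attains a finite positive maximum `S = g(r₀)`;
for the lapse `A_m(r) = 1 − Gm g(r)`, one has `A_m(r) > 0` for all `r > 0` if and only if
`m < m_c = 1/(G S)`. -/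
theorem gaussian_lapse_mass_gap
    (G μ : ℝ) (hG : 0 < G) (hμ : 0 < μ)
    (g : ℝ → ℝ)
    (hg : ∀ r : ℝ, g r = 4 / (Real.sqrt π * r) *
      ∫ t in (0:ℝ)..(μ ^ 2 * r ^ 2 / 4), Real.sqrt t * Real.exp (-t)) :
    ContinuousOn g (Ioi 0) ∧
    (∀ r : ℝ, 0 < r → 0 < g r) ∧
    Tendsto g (nhdsWithin 0 (Ioi 0)) (nhds 0) ∧
    Tendsto g atTop (nhds 0) ∧
    ∃ r₀ : ℝ, 0 < r₀ ∧ (∀ r : ℝ, 0 < r → g r ≤ g r₀) ∧ 0 < g r₀ ∧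
      ∀ m : ℝ, 0 < m →
        ((∀ r : ℝ, 0 < r → 0 < 1 - G * m * g r) ↔ m < 1 / (G * g r₀)) := by
  have hpi : 0 < Real.sqrt π := Real.sqrt_pos.2 Real.pi_pos
  have hcont : ContinuousOn g (Ioi 0) := by
    rw [funext hg]
    refine ContinuousOn.mul ?_ (Continuous.continuousOn ?_)
    · exact continuousOn_const.div (by fun_prop) fun r hr => (mul_pos hpi hr).ne'
    · exact (intervalIntegral.continuous_primitive
        (fun a b => continuous_sqrt_mul_exp_neg.intervalIntegrable a b) 0).comp (by fun_prop)
  have hpos : ∀ r : ℝ, 0 < r → 0 < g r := fun r hr => by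
    rw [hg]
    have := integral_sqrt_mul_exp_neg_pos (x := μ ^ 2 * r ^ 2 / 4) (by positivity)
    positivity
  have hzero : Tendsto g (𝓝[>] 0) (𝓝 0) := by
    have hlin : Tendsto (fun r : ℝ => μ ^ 2 / Real.sqrt π * r) (𝓝[>] 0) (𝓝 0) := by
      have : Continuous fun r : ℝ => μ ^ 2 / Real.sqrt π * r := by fun_prop
      simpa using (this.tendsto 0).mono_left nhdsWithin_le_nhds
    refine squeeze_zero' ?_ ?_ hlin
    · filter_upwards [self_mem_nhdsWithin] with r hr using (hpos r hr).le
    · filter_upwards [self_mem_nhdsWithin] with r hr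
      have hr : 0 < r := hr
      calc g r ≤ 4 / (Real.sqrt π * r) * (μ ^ 2 * r ^ 2 / 4) := by
            rw [hg]
            gcongr
            exact integral_sqrt_mul_exp_neg_le (by positivity)
        _ = μ ^ 2 / Real.sqrt π * r := by field_simp
  have htop : Tendsto g atTop (𝓝 0) := by
    have hx : Tendsto (fun r : ℝ => μ ^ 2 * r ^ 2 / 4) atTop atTop :=
      ((tendsto_pow_atTop two_ne_zero).const_mul_atTop (by positivity)).atTop_div_const
        (by norm_num)
    have hI := intervalIntegral_tendsto_integral_Ioi 0 integrableOn_sqrt_mul_exp_neg hx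
    have hd : Tendsto (fun r : ℝ => 4 / (Real.sqrt π * r)) atTop (𝓝 0) :=
      (tendsto_id.const_mul_atTop hpi).const_div_atTop 4
    rw [funext hg]
    simpa using hd.mul hI
  obtain ⟨r₀, hr₀, hmax⟩ :=
    exists_forall_le_of_tendsto_zero hcont one_pos (hpos 1 one_pos) hzero htop
  have hS := hpos r₀ hr₀
  refine ⟨hcont, hpos, hzero, htop, r₀, hr₀, hmax, hS, fun m hm => ?_⟩
  rw [lt_div_iff₀ (mul_pos hG hS)]
  constructor
  · intro h
    linarith [h r₀ hr₀]
  · intro h r hr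
    have := mul_le_mul_of_nonneg_left (hmax r hr) (mul_pos hG hm).le
    linarith
end
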